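/- arXiv:1711.04537 — 6 statements merged into one kernel-verified Lean document; each statement's English description precedes it below -/
import Mathlib

section
/- For every integer n ≥ 2, D_n = Σ_{k=2}^{n} (k-1) · C(n,k) · D_{n-k}, where C(n,k) denotes the binomial coefficient. -/
/-- `D n` is the number of derangements of an `n`-element set, i.e. the number of
permutations of `{1,...,n}` with no fixed point. -/
def D (n : ℕ) : ℕ := Fintype.card (derangements (Fin n))

theorem aux_B (n : ℕ) :
    ∑ j ∈ Finset.range (n + 2), (n + 1).choose j * numDerangements j
      = ∑ j ∈ Finset.range (n + 1), n.choose j * numDerangements j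
        + ∑ j ∈ Finset.range (n + 1), n.choose j * numDerangements (j + 1) := by
  have := Finset.sum_choose_succ_mul (R := ℕ) (fun i _ => numDerangements i) n
  simpa [add_comm] using this

theorem aux_C (n : ℕ) :
    ∑ j ∈ Finset.range (n + 2), (n + 1).choose j * numDerangements (j + 1)
      = (n + 1) * (∑ j ∈ Finset.range (n + 1), n.choose j * numDerangements j
        + ∑ j ∈ Finset.range (n + 1), n.choose j * numDerangements (j + 1)) := by
  rw [Finset.sum_range_succ', ← Finset.sum_add_distrib, Finset.mul_sum]
  simp only [zero_add, numDerangements_one, mul_zero, add_zero]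
  refine Finset.sum_congr rfl fun i _ => ?_
  rw [numDerangements_add_two]
  have := Nat.add_one_mul_choose_eq n i
  calc _ = ((n + 1).choose (i + 1) * (i + 1)) * (numDerangements i + numDerangements (i + 1)) := by
        ring
    _ = _ := by rw [← this]; ring

theorem aux_fact (n : ℕ) :
    ∑ j ∈ Finset.range (n + 1), n.choose j * numDerangements j = n.factorial := by
  induction n with
  | zero => rfl
  | succ n ih =>
    cases n with
    | zero => rfl
    | succ m =>
      rw [aux_B, aux_C, ← aux_B, ih, Nat.factorial_succ (m + 1)]
      ring

theorem aux_fact_rev (n : ℕ) :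
    ∑ k ∈ Finset.range (n + 1), n.choose k * numDerangements (n - k) = n.factorial := by
  rw [← aux_fact, ← Finset.sum_range_reflect]
  refine Finset.sum_congr rfl fun i hi => ?_
  have hi' : i ≤ n := by simpa [Nat.lt_succ_iff] using hi
  have e : n + 1 - 1 - i = n - i := by omega
  rw [e, Nat.choose_symm hi', Nat.sub_sub_self hi']

theorem derangement_deutsch_elizalde (n : ℕ) (hn : 2 ≤ n) :
    D n = ∑ k ∈ Finset.Icc 2 n, (k - 1) * n.choose k * D (n - k) := by
  have hD : ∀ m, D m = numDerangements m := fun m => card_derangements_fin_eq_numDerangements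
  simp only [hD]
  obtain ⟨m, rfl⟩ := Nat.exists_eq_add_of_le' hn
  have hI : Finset.Icc 2 (m + 2) = Finset.Ico 2 (m + 3) := by ext; simp; omega
  rw [hI, Finset.sum_Ico_eq_sum_range]
  have e : m + 3 - 2 = m + 1 := by omega
  rw [e]
  have h2 := aux_fact_rev (m + 2)
  have h1 := aux_fact_rev (m + 1)
  rw [Finset.sum_range_succ', Finset.sum_range_succ'] at h2
  rw [Finset.sum_range_succ'] at h1
  have key : ∑ i ∈ Finset.range (m + 1), (2 + i - 1) * (m + 2).choose (2 + i)
        * numDerangements (m + 2 - (2 + i))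
      + ∑ i ∈ Finset.range (m + 1), (m + 2).choose (i + 1 + 1)
        * numDerangements (m + 2 - (i + 1 + 1))
      = (m + 2) * ∑ i ∈ Finset.range (m + 1), (m + 1).choose (i + 1)
        * numDerangements (m + 1 - (i + 1)) := by
    rw [← Finset.sum_add_distrib, Finset.mul_sum]
    refine Finset.sum_congr rfl fun i _ => ?_
    have a1 : 2 + i - 1 = i + 1 := by omega
    have a2 : 2 + i = i + 1 + 1 := by omega
    have a3 : m + 2 - (i + 1 + 1) = m + 1 - (i + 1) := by omega
    rw [a1, a2, a3, ← mul_assoc]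
    have := Nat.add_one_mul_choose_eq (m + 1) (i + 1)
    have t : (m + 2) * (m + 1).choose (i + 1) = (m + 2).choose (i + 1 + 1) * (i + 1 + 1) := this
    rw [t]
    ring
  have hf : (m + 2).factorial = (m + 2) * (m + 1).factorial := Nat.factorial_succ (m + 1)
  rw [hf, ← h1, mul_add, ← key] at h2
  simp at h2 ⊢
  linarith
end

section
/- (Theorem 1) For every integer n ≥ 1, 1 + Σ_{k=1}^{n} D_k/k! = D_{n+2}/(n+1)!, where the identity is taken in the rational numbers. -/
theorem derangement_weighted_sum (n : ℕ) (hn : 1 ≤ n) :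
    1 + ∑ k ∈ Finset.Icc 1 n, (D k : ℚ) / k.factorial
      = (D (n + 2) : ℚ) / (n + 1).factorial := by
  have hD : ∀ m, D m = numDerangements m := fun m => by
    unfold D
    rw [← card_derangements_fin_eq_numDerangements]
  clear hn
  induction n with
  | zero => simp [hD, numDerangements_add_two]
  | succ n ih =>
    rw [Finset.sum_Icc_succ_top (by omega), ← add_assoc, ih]
    simp only [hD]
    rw [show n + 1 + 2 = (n + 1) + 2 from rfl, numDerangements_add_two (n + 1),
      Nat.factorial_succ (n + 1)]
    have h1 : ((n + 1).factorial : ℚ) ≠ 0 := by positivity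
    have h2 : ((n : ℚ) + 1 + 1) ≠ 0 := by positivity
    push_cast
    field_simp
    ring
end

section
/- For every integer n ≥ 1, (n+1) divides D_{n+2}, and n! + Σ_{k=2}^{n} (n!/k!) · D_k = D_{n+2}/(n+1). -/
theorem D_sum_aux (n : ℕ) (hn : 1 ≤ n) :
    n.factorial + ∑ k ∈ Finset.Icc 2 n, (n.factorial / k.factorial) * numDerangements k
      = numDerangements n + numDerangements (n + 1) := by
  induction n, hn using Nat.le_induction with
  | base => decide
  | succ n hn ih =>
    rw [Finset.sum_Icc_succ_top (by omega), Nat.div_self (Nat.factorial_pos _)]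
    have h : ∑ k ∈ Finset.Icc 2 n, ((n + 1).factorial / k.factorial) * numDerangements k
        = (n + 1) * ∑ k ∈ Finset.Icc 2 n, (n.factorial / k.factorial) * numDerangements k := by
      rw [Finset.mul_sum]
      refine Finset.sum_congr rfl fun k hk => ?_
      rw [Nat.factorial_succ, Nat.mul_div_assoc _
        (Nat.factorial_dvd_factorial (Finset.mem_Icc.mp hk).2), mul_assoc]
    rw [h, numDerangements_add_two, ← ih, Nat.factorial_succ]
    ring

theorem derangement_weighted_sum_nat (n : ℕ) (hn : 1 ≤ n) :
    (n + 1) ∣ D (n + 2) ∧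
      n.factorial + ∑ k ∈ Finset.Icc 2 n, (n.factorial / k.factorial) * D k
        = D (n + 2) / (n + 1) := by 
  have hD : ∀ m, D m = numDerangements m := fun m => card_derangements_fin_eq_numDerangements
  simp only [hD]
  rw [numDerangements_add_two]
  refine ⟨Dvd.intro _ rfl, ?_⟩
  rw [Nat.mul_div_cancel_left _ (Nat.succ_pos n)]
  exact D_sum_aux n hn
end

section
/- (Theorem 2) For every integer n ≥ 1, 1 + Σ_{k=1}^{n} (-1)^k · D_{k+3}/(k+2) = (-1)^n · D_{n+2}, where the identity is taken in the rational numbers. -/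
theorem D_rec (n : ℕ) : D (n + 2) = (n + 1) * (D n + D (n + 1)) := by
  simp only [D, card_derangements_fin_eq_numDerangements]
  exact numDerangements_add_two n

theorem D_two : D 2 = 1 := by
  simp only [D, card_derangements_fin_eq_numDerangements]
  rfl

theorem derangement_alternating_sum (n : ℕ) (hn : 1 ≤ n) :
    1 + ∑ k ∈ Finset.Icc 1 n, (-1 : ℚ) ^ k * (D (k + 3) : ℚ) / (k + 2)
      = (-1 : ℚ) ^ n * D (n + 2) := by
  clear hn
  induction n with
  | zero => simp [D_two]
  | succ n ih =>
    rw [Finset.sum_Icc_succ_top (by omega), ← add_assoc, ih, D_rec (n + 1 + 1)]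
    have h : ((n : ℚ) + 1 + 2) ≠ 0 := by positivity
    push_cast
    rw [show n + 1 + 2 = n + 1 + 1 + 1 from rfl, show n + 2 = n + 1 + 1 from rfl]
    field_simp
    ring
end

section
/- For all integers n ≥ 1 and r ≥ 0, 1 + Σ_{k=1}^{n} D_{k+r}(r) / (k! · C(k+r, r)) = D_{n+r+2}(r) / ((n+1)! · C(n+r+2, r)), where the identity is taken in the rational numbers and C(m,r) denotes the binomial coefficient. -/
/-- The rencontres number `R n r` is the number of permutations of `{1,...,n}`
having exactly `r` fixed points. -/
def R (n r : ℕ) : ℕ :=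
  (Finset.univ.filter fun σ : Equiv.Perm (Fin n) =>
    (Finset.univ.filter fun x : Fin n => σ x = x).card = r).card

theorem card_fixed_eq (n : ℕ) (s : Finset (Fin n)) :
    (Finset.univ.filter fun σ : Equiv.Perm (Fin n) =>
      (Finset.univ.filter fun x : Fin n => σ x = x) = s).card = numDerangements (n - s.card) := by
  have h1 : Fintype.card {x : Fin n // x ∉ s} = n - s.card := by
    simp [Fintype.card_subtype_compl]
  rw [← h1, ← card_derangements_eq_numDerangements, ← Fintype.card_subtype]
  refine Fintype.card_congr (Equiv.trans (Equiv.subtypeEquivRight ?_)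
    (derangements.subtypeEquiv (fun x : Fin n => x ∉ s)).symm)
  intro σ
  simp only [Finset.ext_iff, Finset.mem_filter, Finset.mem_univ, true_and,
    Function.mem_fixedPoints, Function.IsFixedPt, not_not]
  exact ⟨fun h a => (h a).symm, fun h a => (h a).symm⟩

theorem R_eq (m r : ℕ) : R (m + r) r = (m + r).choose r * numDerangements m := by
  unfold R
  rw [Finset.card_eq_sum_card_fiberwise
    (f := fun σ : Equiv.Perm (Fin (m + r)) => Finset.univ.filter fun x => σ x = x)
    (t := Finset.powersetCard r Finset.univ)]
  · rw [Finset.sum_congr rfl (g := fun _ => numDerangements m)]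
    · simp
    · intro s hs
      rw [Finset.mem_powersetCard] at hs
      have := card_fixed_eq (m + r) s
      rw [hs.2, Nat.add_sub_cancel] at this
      rw [← this, Finset.filter_filter]
      congr 1
      apply Finset.filter_congr
      intro σ _
      constructor
      · exact fun h => h.2
      · intro h
        exact ⟨by rw [h]; exact hs.2, h⟩
  · intro σ hσ
    simpa [Finset.mem_powersetCard] using hσ

theorem rencontres_weighted_sum (n r : ℕ) (hn : 1 ≤ n) :
    1 + ∑ k ∈ Finset.Icc 1 n, (R (k + r) r : ℚ) / (k.factorial * (k + r).choose r)
      = (R (n + r + 2) r : ℚ) / ((n + 1).factorial * (n + r + 2).choose r) := by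
  have key : ∀ m k : ℕ, (R (m + r) r : ℚ) / (k.factorial * (m + r).choose r)
      = numDerangements m / k.factorial := by
    intro m k
    have h1 : ((m + r).choose r : ℚ) ≠ 0 := by
      exact_mod_cast (Nat.choose_pos (Nat.le_add_left r m)).ne'
    have h2 : (k.factorial : ℚ) ≠ 0 := by exact_mod_cast k.factorial_ne_zero
    rw [R_eq]
    push_cast
    field_simp
  rw [show n + r + 2 = (n + 2) + r by ring, key, Finset.sum_congr rfl (fun k _ => key k k)]
  clear hn
  induction n with
  | zero => simp [numDerangements]
  | succ n ih =>
    rw [Finset.sum_Icc_succ_top (by omega), ← add_assoc, ih,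
      show n + 1 + 2 = (n + 1) + 2 by ring, numDerangements_add_two (n + 1),
      Nat.factorial_succ (n + 1)]
    have h2 : ((n + 1).factorial : ℚ) ≠ 0 := by exact_mod_cast (n + 1).factorial_ne_zero
    have h3 : (n : ℚ) + 1 + 1 ≠ 0 := by positivity
    push_cast
    field_simp
    ring
end

section
/- Let n ≥ 2 and let j, k be distinct elements of {1,...,n}. Then the number of derangements σ of {1,...,n} with σ(k) = j, multiplied by (n-1), equals D_n; in particular this count equals D_n/(n-1) and is independent of the choice of the distinct pair (j,k). -/
theorem card_derangements_aux (n : ℕ) (i j k : Fin n) (hi : i ≠ k) (hj : j ≠ k) :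
    (Finset.univ.filter fun σ : Equiv.Perm (Fin n) => (∀ x, σ x ≠ x) ∧ σ k = i).card ≤
    (Finset.univ.filter fun σ : Equiv.Perm (Fin n) => (∀ x, σ x ≠ x) ∧ σ k = j).card := by
  apply Finset.card_le_card_of_injOn
    (fun σ => Equiv.swap i j * σ * Equiv.swap i j)
  · intro σ hσ
    simp only [Finset.coe_filter, Finset.mem_univ, true_and, Set.mem_ofPred_eq] at hσ ⊢
    obtain ⟨h1, h2⟩ := hσ
    refine ⟨fun x hx => h1 (Equiv.swap i j x) ?_, ?_⟩
    · simp only [Equiv.Perm.mul_apply] at hx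
      have := congrArg (Equiv.swap i j) hx
      simpa using this
    · simp only [Equiv.Perm.mul_apply]
      rw [Equiv.swap_apply_of_ne_of_ne hi.symm hj.symm, h2, Equiv.swap_apply_left]
  · intro a _ b _ h
    simpa using h

theorem card_derangements_with_prescribed_value (n : ℕ) (hn : 2 ≤ n) (j k : Fin n)
    (hjk : j ≠ k) :
    (Finset.univ.filter fun σ : Equiv.Perm (Fin n) =>
        (∀ x, σ x ≠ x) ∧ σ k = j).card * (n - 1) = D n ∧
      (Finset.univ.filter fun σ : Equiv.Perm (Fin n) =>
        (∀ x, σ x ≠ x) ∧ σ k = j).card = D n / (n - 1) := by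
  have main : (Finset.univ.filter fun σ : Equiv.Perm (Fin n) =>
        (∀ x, σ x ≠ x) ∧ σ k = j).card * (n - 1) = D n := by
    have hD : D n = (Finset.univ.filter fun σ : Equiv.Perm (Fin n) => ∀ x, σ x ≠ x).card := by
      unfold D
      exact Fintype.card_of_subtype _ (by intro x; simp [derangements])
    rw [hD, Finset.card_eq_sum_card_fiberwise 
      (s := Finset.univ.filter fun σ : Equiv.Perm (Fin n) => ∀ x, σ x ≠ x) (f := fun σ => σ k)
      (t := Finset.univ.erase k) (by intro σ hσ; simp at hσ ⊢; exact hσ k)]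
    rw [Finset.sum_congr rfl (g := fun _ => (Finset.univ.filter fun σ : Equiv.Perm (Fin n) =>
        (∀ x, σ x ≠ x) ∧ σ k = j).card)]
    · rw [Finset.sum_const, Finset.card_erase_of_mem (Finset.mem_univ k), Finset.card_univ,
        Fintype.card_fin, smul_eq_mul, mul_comm]
    · intro i hi
      have hi' : i ≠ k := Finset.ne_of_mem_erase hi
      rw [Finset.filter_filter]
      exact le_antisymm (card_derangements_aux n i j k hi' hjk)
        (card_derangements_aux n j i k hjk hi')
  refine ⟨main, ?_⟩
  rw [← main, Nat.mul_div_cancel _ (by omega)]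
end
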